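/- arXiv:2112.06706 — 2 statements merged into one kernel-verified Lean document; each statement's English description precedes it below -/
import Mathlib

section
/- For all (t,x) ∈ [0,T]×ℝ, with f¹(t) = (μ/(σ²m))·e^{-r(T-t)}, the identity ((f¹(t) - β)μ - ρ)·∂_x V¹(t,x) + (1/2)σ²·((f¹(t))² - β²)·∂_{xx} V¹(t,x) = h(t)·exp((-m·x - d(t))·e^{r(T-t)} + g(t)) = -m·h(t)·V¹(t,x) holds. -/
/-- The derivative of `y ↦ c * exp ((-(m * y) - a) * E + b)`. -/
theorem deriv_const_mul_exp_affine (c m a E b : ℝ) :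
    deriv (fun y : ℝ => c * Real.exp ((-(m * y) - a) * E + b)) =
      fun y => (-(c * m * E)) * Real.exp ((-(m * y) - a) * E + b) := by
  funext y
  have haff : HasDerivAt (fun y : ℝ => (-(m * y) - a) * E + b) (-(m * 1) * E) y :=
    ((((hasDerivAt_id' y).const_mul m).neg.sub_const a).mul_const E).add_const b
  rw [(haff.exp.const_mul c).deriv]
  ring

/-- The identity
`((f¹(t)-β)μ - ρ)·∂ₓV¹ + (1/2)σ²((f¹(t))² - β²)·∂ₓₓV¹
  = h(t)·exp((-mx - d(t))·e^{r(T-t)} + g(t)) = -m·h(t)·V¹(t,x)` on `[0,T]×ℝ`. -/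
theorem stmt_8
    (r μ σ m β T δ ρ : ℝ)
    (hr : 0 < r) (hμ : 0 < μ) (hσ : 0 < σ) (hm : 0 < m) (hβ : 0 < β) (hT : 0 < T)
    (hδ : 0 ≤ δ) (hρ : 0 ≤ ρ)
    (d g : ℝ → ℝ) (V1 : ℝ → ℝ → ℝ) (f1 h : ℝ → ℝ)
    (hd : ∀ t, d t = -((δ + ρ) * m / r) * (1 - Real.exp (-(r * (T - t)))))
    (hg : ∀ t, g t = -(μ ^ 2 / (2 * σ ^ 2)) * (T - t))
    (hV1 : ∀ t x, V1 t x =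
      -(1 / m) * Real.exp ((-(m * x) - d t) * Real.exp (r * (T - t)) + g t))
    (hf1 : ∀ t, f1 t = (μ / (σ ^ 2 * m)) * Real.exp (-(r * (T - t))))
    (hh : ∀ t, h t = μ ^ 2 / (2 * σ ^ 2 * m)
      + (1 / 2) * β ^ 2 * σ ^ 2 * m * Real.exp (2 * r * (T - t))
      - (β * μ + ρ) * Real.exp (r * (T - t))) :
    ∀ t ∈ Set.Icc (0 : ℝ) T, ∀ x : ℝ,
      ((f1 t - β) * μ - ρ) * deriv (fun y => V1 t y) x
        + (1 / 2) * σ ^ 2 * ((f1 t) ^ 2 - β ^ 2) * deriv (deriv (fun y => V1 t y)) x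
      = h t * Real.exp ((-(m * x) - d t) * Real.exp (r * (T - t)) + g t) ∧
      h t * Real.exp ((-(m * x) - d t) * Real.exp (r * (T - t)) + g t)
      = -(m * h t * V1 t x) := by
  intro t _ x
  have hV : (fun y => V1 t y) = fun y =>
      -(1 / m) * Real.exp ((-(m * y) - d t) * Real.exp (r * (T - t)) + g t) :=
    funext (hV1 t)
  have hE2 : Real.exp (2 * r * (T - t)) = Real.exp (r * (T - t)) ^ 2 := by
    rw [← Real.exp_nat_mul]
    push_cast
    ring_nf
  have hE : Real.exp (r * (T - t)) ≠ 0 := Real.exp_ne_zero _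
  rw [hV, deriv_const_mul_exp_affine, deriv_const_mul_exp_affine, hV1, hf1, hh, hE2, Real.exp_neg]
  beta_reduce
  generalize Real.exp ((-(m * x) - d t) * Real.exp (r * (T - t)) + g t) = X
  generalize Real.exp (r * (T - t)) = E at hE ⊢
  constructor
  · field_simp
    ring
  · field_simp
end

section
/- Assume μ/σ² > β·m and ρ ≤ μ²/(2σ²m) + (1/2)β²σ²m - βμ. Then P, ∂_t P, and ∂_x P are continuous functions on [t₁,T]×ℝ; in particular, P and its first partial derivatives in t and x extend continuously across the boundary t = t₂. -/
/-- Freezing a function at a critical point `a` gives a function differentiable everywhere. -/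
theorem hasDerivAt_comp_min {F G : ℝ → ℝ} {a : ℝ} (hF : ∀ t, HasDerivAt F (G t) t)
    (ha : G a = 0) (t : ℝ) : HasDerivAt (fun s => F (min s a)) (G (min t a)) t := by
  rcases lt_trichotomy t a with hlt | rfl | hgt
  · rw [min_eq_left hlt.le]
    refine (hF t).congr_of_eventuallyEq ?_
    filter_upwards [Iio_mem_nhds hlt] with s hs
    rw [min_eq_left (le_of_lt hs)]
  · rw [min_self, ha, ← hasDerivWithinAt_univ, ← Set.Iic_union_Ici (a := t)]
    refine HasDerivWithinAt.union ?_ ?_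
    · rw [← ha]
      exact (hF t).hasDerivWithinAt.congr (fun s hs => by rw [min_eq_left hs])
        (by rw [min_self])
    · exact (hasDerivWithinAt_const t _ (F t)).congr (fun s hs => by rw [min_eq_right hs])
        (by rw [min_self])
  · rw [min_eq_right hgt.le, ha]
    refine (hasDerivAt_const t (F a)).congr_of_eventuallyEq ?_
    filter_upwards [Ioi_mem_nhds hgt] with s hs
    rw [min_eq_right (le_of_lt hs)]

/-- A function vanishing on `[a, ∞)` has `deriv` zero there, endpoint included. -/
theorem deriv_eq_zero_of_eqOn_Ici {F : ℝ → ℝ} {a t : ℝ} (hF : ∀ s, a ≤ s → F s = 0)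
    (ht : a ≤ t) : deriv F t = 0 := by
  by_cases hd : DifferentiableAt ℝ F t
  · have hu : UniqueDiffWithinAt ℝ (Set.Ici t) t := uniqueDiffOn_Ici t t Set.self_mem_Ici
    have h0 : HasDerivWithinAt F 0 (Set.Ici t) t :=
      (hasDerivWithinAt_const t _ (0 : ℝ)).congr (fun s hs => hF s (ht.trans hs)) (hF t ht)
    exact hu.eq_deriv _ hd.hasDerivAt.hasDerivWithinAt h0
  · exact deriv_zero_of_not_differentiableAt hd

/-- The first point `b > a` of `[a, c]` where a continuous function is nonnegative is a zero. -/
theorem eq_zero_of_eq_sInf_nonneg {h : ℝ → ℝ} (hh : Continuous h) {a b c : ℝ}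
    (hb : b = sInf {t ∈ Set.Icc a c | 0 ≤ h t}) (hne : {t ∈ Set.Icc a c | 0 ≤ h t}.Nonempty)
    (hab : a < b) : h b = 0 := by
  have hcl : IsClosed {t ∈ Set.Icc a c | 0 ≤ h t} :=
    isClosed_Icc.inter (isClosed_le continuous_const hh)
  have hbdd : BddBelow {t ∈ Set.Icc a c | 0 ≤ h t} := ⟨a, fun t ht => ht.1.1⟩
  have hmem := hcl.csInf_mem hne hbdd
  rw [← hb] at hmem
  refine le_antisymm ?_ hmem.2
  refine le_of_tendsto (hh.continuousWithinAt (s := Set.Iio b) (x := b)) ?_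
  filter_upwards [Ioo_mem_nhdsLT hab] with t ht
  by_contra! hpos
  exact absurd (hb ▸ csInf_le hbdd ⟨⟨ht.1.le, ht.2.le.trans hmem.1.2⟩, hpos.le⟩)
    (not_le.mpr ht.2)


/-- `P`, `∂ₜP`, and `∂ₓP` are continuous on `[t₁,T]×ℝ`; in particular they
extend continuously across the boundary `t = t₂`. -/
theorem stmt_10
    (r μ σ m β T δ ρ : ℝ)
    (hr : 0 < r) (hμ : 0 < μ) (hσ : 0 < σ) (hm : 0 < m) (hβ : 0 < β) (hT : 0 < T)
    (hδ : 0 ≤ δ) (hρ : 0 ≤ ρ)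
    (hcond1 : β * m < μ / σ ^ 2)
    (hcond2 : ρ ≤ μ ^ 2 / (2 * σ ^ 2 * m) + (1 / 2) * β ^ 2 * σ ^ 2 * m - β * μ)
    (d g : ℝ → ℝ) (V1 : ℝ → ℝ → ℝ) (f1 h : ℝ → ℝ)
    (hd : ∀ t, d t = -((δ + ρ) * m / r) * (1 - Real.exp (-(r * (T - t)))))
    (hg : ∀ t, g t = -(μ ^ 2 / (2 * σ ^ 2)) * (T - t))
    (hV1 : ∀ t x, V1 t x =
      -(1 / m) * Real.exp ((-(m * x) - d t) * Real.exp (r * (T - t)) + g t))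
    (hf1 : ∀ t, f1 t = (μ / (σ ^ 2 * m)) * Real.exp (-(r * (T - t))))
    (hh : ∀ t, h t = μ ^ 2 / (2 * σ ^ 2 * m)
      + (1 / 2) * β ^ 2 * σ ^ 2 * m * Real.exp (2 * r * (T - t))
      - (β * μ + ρ) * Real.exp (r * (T - t)))
    (t₁ : ℝ) (ht₁ : t₁ = sInf {t ∈ Set.Icc (0 : ℝ) T | β ≤ f1 t})
    (t₂ : ℝ) (ht₂ : t₂ = sInf {t ∈ Set.Icc t₁ T | 0 ≤ h t})
    (P : ℝ → ℝ → ℝ)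
    (hP : ∀ t x, P t x =
      if t < t₂ then -(1 - Real.exp (∫ s in t..t₂, m * h s)) * V1 t x else 0) :
    ContinuousOn (fun p : ℝ × ℝ => P p.1 p.2) (Set.Icc t₁ T ×ˢ (Set.univ : Set ℝ)) ∧
    ContinuousOn (fun p : ℝ × ℝ => deriv (fun s => P s p.2) p.1)
      (Set.Icc t₁ T ×ˢ (Set.univ : Set ℝ)) ∧
    ContinuousOn (fun p : ℝ × ℝ => deriv (fun y => P p.1 y) p.2)
      (Set.Icc t₁ T ×ˢ (Set.univ : Set ℝ)) := by
  have hdf : d = fun t => -((δ + ρ) * m / r) * (1 - Real.exp (-(r * (T - t)))) := funext hd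
  have hgf : g = fun t => -(μ ^ 2 / (2 * σ ^ 2)) * (T - t) := funext hg
  have hhf : h = fun t => μ ^ 2 / (2 * σ ^ 2 * m)
      + (1 / 2) * β ^ 2 * σ ^ 2 * m * Real.exp (2 * r * (T - t))
      - (β * μ + ρ) * Real.exp (r * (T - t)) := funext hh
  have hd_cont : Continuous d := by rw [hdf]; fun_prop
  have hg_cont : Continuous g := by rw [hgf]; fun_prop
  have hh_cont : Continuous h := by rw [hhf]; fun_prop
  have hd' (t : ℝ) : HasDerivAt d ((δ + ρ) * m * Real.exp (-(r * (T - t)))) t := by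
    rw [hdf]
    refine HasDerivAt.congr_deriv (((((((hasDerivAt_id' t).const_sub T).const_mul r).fun_neg.exp).const_sub 1).const_mul
      (-((δ + ρ) * m / r)))) ?_
    field_simp
  have hg' (t : ℝ) : HasDerivAt g (μ ^ 2 / (2 * σ ^ 2)) t := by
    rw [hgf]
    refine HasDerivAt.congr_deriv (((hasDerivAt_id' t).const_sub T).const_mul (-(μ ^ 2 / (2 * σ ^ 2)))) ?_
    ring
  have he' (t : ℝ) : HasDerivAt (fun s => Real.exp (r * (T - s)))
      (-r * Real.exp (r * (T - t))) t := by
    refine HasDerivAt.congr_deriv ((((hasDerivAt_id' t).const_sub T).const_mul r).exp) ?_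
    ring
  have hV_t (t x : ℝ) : HasDerivAt (fun s => V1 s x)
      (V1 t x * (-((δ + ρ) * m * Real.exp (-(r * (T - t)))) * Real.exp (r * (T - t))
        + (-(m * x) - d t) * (-r * Real.exp (r * (T - t))) + μ ^ 2 / (2 * σ ^ 2))) t := by
    simp only [hV1]
    refine HasDerivAt.congr_deriv ((((((hd' t).const_sub (-(m * x))).fun_mul (he' t)).fun_add (hg' t)).exp).const_mul
      (-(1 / m))) ?_
    ring
  have hV_x (t x : ℝ) : HasDerivAt (fun y => V1 t y)
      (V1 t x * (-m * Real.exp (r * (T - t)))) x := by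
    simp only [hV1]
    refine HasDerivAt.congr_deriv (((((((hasDerivAt_id' x).const_mul m).fun_neg.sub_const (d t)).mul_const
      (Real.exp (r * (T - t)))).add_const (g t)).exp).const_mul (-(1 / m))) ?_
    ring
  have hV_cont : Continuous fun p : ℝ × ℝ => V1 p.1 p.2 := by
    simp only [hV1]; fun_prop
  have hH' (t : ℝ) : HasDerivAt (fun s => ∫ u in s..t₂, m * h u) (-(m * h t)) t :=
    intervalIntegral.integral_hasDerivAt_left ((hh_cont.const_mul m).intervalIntegrable _ _)
      ((hh_cont.const_mul m).stronglyMeasurableAtFilter _ _) (hh_cont.const_mul m).continuousAt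
  set H : ℝ → ℝ := fun s => ∫ u in s..t₂, m * h u with hHdef
  have hH_cont : Continuous H :=
    continuous_iff_continuousAt.mpr fun t => (hH' t).continuousAt
  have hH_end : H t₂ = 0 := intervalIntegral.integral_same
  have hP_min (t x : ℝ) :
      P t x = -(1 - Real.exp (H (min t t₂))) * V1 (min t t₂) x := by
    rw [hP]
    split_ifs with hlt
    · rw [min_eq_left hlt.le]
    · rw [min_eq_right (not_lt.mp hlt), hH_end]
      simp
  have hmin : Continuous fun p : ℝ × ℝ => ((min p.1 t₂, p.2) : ℝ × ℝ) := by fun_prop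
  have hVmin : Continuous fun p : ℝ × ℝ => V1 (min p.1 t₂) p.2 := hV_cont.comp hmin
  have hP_zero (t x : ℝ) (ht : t₂ ≤ t) : P t x = 0 := by
    rw [hP, if_neg (not_lt.mpr ht)]
  refine ⟨?_, ?_, ?_⟩
  · simp only [hP_min]
    fun_prop
  · have hne : {t ∈ Set.Icc t₁ T | 0 ≤ h t}.Nonempty := by
      have hT_mem : T ∈ {t ∈ Set.Icc (0 : ℝ) T | β ≤ f1 t} := by
        refine ⟨⟨hT.le, le_rfl⟩, ?_⟩
        rw [hf1, sub_self, mul_zero, neg_zero, Real.exp_zero, mul_one, ← div_div, le_div_iff₀ hm]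
        exact hcond1.le
      refine ⟨T, ⟨?_, le_rfl⟩, ?_⟩
      · rw [ht₁]
        exact csInf_le ⟨0, fun t ht => ht.1.1⟩ hT_mem
      · rw [hh]
        simp only [sub_self, mul_zero, Real.exp_zero]
        linarith
    rcases lt_or_ge t₁ t₂ with hlt | hge
    · have hz : h t₂ = 0 := eq_zero_of_eq_sInf_nonneg hh_cont ht₂ hne hlt
      have hderiv (t x : ℝ) := ((hH' t).exp.const_sub 1).fun_neg.fun_mul (hV_t t x)
      have hP_t (t x : ℝ) := (hasDerivAt_comp_min (a := t₂) (fun t => hderiv t x)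
        (by simp only [hz, hH_end]; simp) t).deriv
      simp only [hP_min, hP_t]
      fun_prop
    · refine continuousOn_const (c := (0 : ℝ)).congr fun p hp => ?_
      exact deriv_eq_zero_of_eqOn_Ici (fun s hs => hP_zero s p.2 hs) (hge.trans hp.1.1)
  · have hP_x (t x : ℝ) := ((hV_x (min t t₂) x).const_mul (-(1 - Real.exp (H (min t t₂))))).deriv
    simp only [hP_min, hP_x]
    fun_prop
end
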